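/- Let F_1,…,F_n : ℝ^d → ℝ be G-Lipschitz and L-smooth, let θ ∈ (0,1], m ≤ n, τ ≥ 1, and let 0 < γ ≤ 1/(4τL). Consider the random process: w^0 ∈ ℝ^d deterministic; for each round t = 0,…,T−1, a subset S^t ⊆ {1,…,n} of size m is drawn uniformly at random, independently across rounds; π^t is a maximizer of π ↦ ∑_{i∈S^t} π_i F_i(w^t) over P_{θ,S^t}; each i ∈ S^t runs local gradient descent w_{i,0}^t = w^t, w_{i,k+1}^t = w_{i,k}^t − γ∇F_i(w_{i,k}^t) for k = 0,…,τ−1; and w^{t+1} = ∑_{i∈S^t} π_i^t w_{i,τ}^t. Let F̄_θ(w) = E_{S∼U_m}[max_{π∈P_{θ,S}} ∑_{i∈S} π_i F_i(w)], let Φ̄_θ^μ be its Moreau envelope with parameter μ = 2L, i.e. Φ̄_θ^μ(w) = inf_z { F̄_θ(z) + (μ/2)‖w−z‖² }, and let Δ = Φ̄_θ^μ(w^0) − inf_w Φ̄_θ^μ(w). Then (1/T) ∑_{t=0}^{T−1} E‖∇Φ̄_θ^{2L}(w^t)‖² ≤ 4Δ/(τγT) + 4τγLG²(1 + 8Lγ(τ−1)).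 -/

import Mathlib

open scoped BigOperators

open scoped RealInnerProductSpace

noncomputable section

section Analytic

variable {E : Type*} [NormedAddCommGroup E] [InnerProductSpace ℝ E]

lemma norm_gradient_le_of_lipschitz [CompleteSpace E] {f : E → ℝ} {G : ℝ} (hG : 0 ≤ G)
    (hf : ∀ v v', |f v - f v'| ≤ G * ‖v - v'‖) (v : E) : ‖gradient f v‖ ≤ G := by
  rw [gradient, LinearIsometryEquiv.norm_map]
  exact norm_fderiv_le_of_lip' ℝ hG (Filter.Eventually.of_forall fun x => hf x v)

/-- A function with `L`-Lipschitz gradient lies above its quadratic minorants. -/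
lemma quadratic_minorant_of_lipschitz_gradient [CompleteSpace E] {f : E → ℝ} {L : ℝ}
    (hf : Differentiable ℝ f)
    (hgrad : ∀ v v', ‖gradient f v - gradient f v'‖ ≤ L * ‖v - v'‖) (v z : E) :
    f v + ⟪gradient f v, z - v⟫ - L / 2 * ‖z - v‖ ^ 2 ≤ f z := by
  set h : ℝ → ℝ := fun s =>
    f (v + s • (z - v)) - s * ⟪gradient f v, z - v⟫ + L / 2 * ‖z - v‖ ^ 2 * s ^ 2 with hh
  have hderiv : ∀ s : ℝ, HasDerivAt h
      (⟪gradient f (v + s • (z - v)) - gradient f v, z - v⟫ + L * s * ‖z - v‖ ^ 2) s := by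
    intro s
    have hline : HasDerivAt (fun s : ℝ => v + s • (z - v)) (z - v) s := by
      simpa using ((hasDerivAt_id s).smul_const (z - v)).const_add v
    have hcomp := ((hf (v + s • (z - v))).hasGradientAt.hasFDerivAt).comp_hasDerivAt s hline
    have hlin := (hasDerivAt_id s).mul_const ⟪gradient f v, z - v⟫
    have hsq := ((hasDerivAt_id s).pow 2).const_mul (L / 2 * ‖z - v‖ ^ 2)
    refine ((hcomp.sub hlin).add hsq).congr_deriv ?_
    simp only [InnerProductSpace.toDual_apply_apply, inner_sub_left, id]
    norm_num
    ring
  have hmono : MonotoneOn h (Set.Icc 0 1) := by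
    refine monotoneOn_of_deriv_nonneg (convex_Icc 0 1)
      (fun s _ => (hderiv s).continuousAt.continuousWithinAt)
      (fun s _ => (hderiv s).differentiableAt.differentiableWithinAt) fun s hs => ?_
    rw [interior_Icc] at hs
    rw [(hderiv s).deriv]
    have hcs := neg_le_of_abs_le
      (abs_real_inner_le_norm (gradient f (v + s • (z - v)) - gradient f v) (z - v))
    have hlip := hgrad (v + s • (z - v)) v
    rw [add_sub_cancel_left, norm_smul, Real.norm_of_nonneg hs.1.le] at hlip
    have := mul_le_mul_of_nonneg_right hlip (norm_nonneg (z - v))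
    nlinarith
  have := hmono (Set.left_mem_Icc.2 zero_le_one) (Set.right_mem_Icc.2 zero_le_one) zero_le_one
  simp only [hh, zero_smul, add_zero, one_smul, add_sub_cancel] at this
  linarith

/-- A Lipschitz function on a finite-dimensional space has proximal points. -/
lemma exists_prox_of_lipschitz [FiniteDimensional ℝ E] {f : E → ℝ} {G L : ℝ} (hL : 0 < L)
    (hf : ∀ v v', |f v - f v'| ≤ G * ‖v - v'‖) (v : E) :
    ∃ p, ∀ z, f p + L * ‖v - p‖ ^ 2 ≤ f z + L * ‖v - z‖ ^ 2 := by
  have : ProperSpace E := FiniteDimensional.proper ℝ E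
  have hcont : Continuous f := by
    refine (LipschitzWith.of_dist_le_mul (K := G.toNNReal) fun x y => ?_).continuous
    rw [Real.dist_eq, dist_eq_norm]
    exact (hf x y).trans
      (mul_le_mul_of_nonneg_right (Real.le_coe_toNNReal G) (norm_nonneg _))
  refine Continuous.exists_forall_le (f := fun z => f z + L * ‖v - z‖ ^ 2) (by fun_prop) ?_
  have hdist : Filter.Tendsto (fun z => ‖v - z‖) (Filter.cocompact E) Filter.atTop :=
    (tendsto_dist_left_cocompact_atTop v).congr fun z => dist_eq_norm v z
  have hquad : Filter.Tendsto (fun r : ℝ => f v + r * (L * r - G)) Filter.atTop Filter.atTop :=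
    Filter.tendsto_atTop_add_const_left _ _ <| Filter.tendsto_id.atTop_mul_atTop₀ <|
      Filter.tendsto_atTop_add_const_right _ _ (Filter.tendsto_id.const_mul_atTop hL)
  refine Filter.tendsto_atTop_mono (fun z => ?_) (hquad.comp hdist)
  have := le_of_abs_le (hf v z)
  simp only [Function.comp]
  nlinarith

/-- Quadratic growth at a proximal point of a function with quadratic minorants. -/
lemma quadratic_growth_prox {f : E → ℝ} {g : E → E} {L : ℝ}
    (hsub : ∀ v z, f v + ⟪g v, z - v⟫ - L / 2 * ‖z - v‖ ^ 2 ≤ f z) {v p : E}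
    (hp : ∀ z, f p + L * ‖v - p‖ ^ 2 ≤ f z + L * ‖v - z‖ ^ 2) :
    f p + 3 / 2 * L * ‖v - p‖ ^ 2 ≤ f v := by
  have hseg : ∀ s ∈ Set.Ioo (0 : ℝ) 1,
      L * ‖v - p‖ ^ 2 * (2 - s) - L / 2 * (1 - s) * ‖v - p‖ ^ 2 ≤ f v - f p := by
    intro s hs
    set q := p + s • (v - p) with hq
    have hvq : v - q = (1 - s) • (v - p) := by rw [hq]; module
    have hpq : p - q = (-s) • (v - p) := by rw [hq]; module
    have h1 := hsub q v
    have h2 := hsub q p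
    have h3 := hp q
    rw [hvq] at h1 h3
    rw [hpq] at h2
    rw [inner_smul_right, norm_smul, mul_pow, Real.norm_eq_abs, sq_abs] at h1 h2
    rw [norm_smul, mul_pow, Real.norm_eq_abs, sq_abs] at h3
    have h4 := mul_le_mul_of_nonneg_left h1 hs.1.le
    have h5 := mul_le_mul_of_nonneg_left h2 (sub_nonneg.2 hs.2.le)
    refine le_of_mul_le_mul_left ?_ hs.1
    linarith
  have hlim : Filter.Tendsto
      (fun s : ℝ => L * ‖v - p‖ ^ 2 * (2 - s) - L / 2 * (1 - s) * ‖v - p‖ ^ 2)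
      (nhdsWithin 0 (Set.Ioi 0))
      (nhds (L * ‖v - p‖ ^ 2 * (2 - 0) - L / 2 * (1 - 0) * ‖v - p‖ ^ 2)) :=
    (Continuous.tendsto (by fun_prop) 0).mono_left nhdsWithin_le_nhds
  have := le_of_tendsto hlim
    (Filter.eventually_of_mem (Ioo_mem_nhdsGT zero_lt_one) hseg)
  linarith

/-- A function touched from above at `v` by `c + L‖· - p‖²` has gradient of norm at most
`2L‖v - p‖` there (the gradient being zero by convention at points of nondifferentiability). -/
lemma norm_gradient_le_of_quadratic_majorant [CompleteSpace E] {Φ : E → ℝ} {L c : ℝ}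
    (hL : 0 ≤ L) {v p : E} (hle : ∀ x, Φ x ≤ c + L * ‖x - p‖ ^ 2)
    (heq : Φ v = c + L * ‖v - p‖ ^ 2) : ‖gradient Φ v‖ ≤ 2 * L * ‖v - p‖ := by
  by_cases hd : DifferentiableAt ℝ Φ v
  · have hq : HasFDerivAt (fun x => c + L * ‖x - p‖ ^ 2)
        (L • (2 • (innerSL ℝ (v - p)).comp (ContinuousLinearMap.id ℝ E))) v :=
      ((((hasFDerivAt_id v).sub_const p).norm_sq).const_mul L).const_add c
    have hmin : IsLocalMin (fun x => (c + L * ‖x - p‖ ^ 2) - Φ x) v :=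
      Filter.Eventually.of_forall fun x => by
        have := hle x
        simp only [heq]
        linarith
    have hzero := hmin.hasFDerivAt_eq_zero (hq.sub hd.hasFDerivAt)
    rw [gradient, LinearIsometryEquiv.norm_map, ← sub_eq_zero.1 hzero]
    refine ContinuousLinearMap.opNorm_le_bound _ (by positivity) fun y => ?_
    simp only [smul_apply, ContinuousLinearMap.comp_apply, smul_eq_mul,
      ContinuousLinearMap.id_apply, innerSL_apply_apply, nsmul_eq_mul, Nat.cast_ofNat,
      norm_mul, Real.norm_of_nonneg hL, RCLike.norm_ofNat]
    have := mul_le_mul_of_nonneg_left (norm_inner_le_norm (𝕜 := ℝ) (v - p) y) hL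
    linarith
  · rw [gradient, fderiv_zero_of_not_differentiableAt hd, map_zero, norm_zero]
    positivity

/-- Progress of `k` gradient descent steps towards a reference point `p`. -/
lemma gradientDescent_dist_sq_le [CompleteSpace E] {f : E → ℝ} {G L γ : ℝ} (hL : 0 ≤ L)
    (hγ : 0 ≤ γ) (hG : ∀ v, ‖gradient f v‖ ≤ G)
    (hgrad : ∀ v v', ‖gradient f v - gradient f v'‖ ≤ L * ‖v - v'‖)
    {u : ℕ → E} (hu : ∀ k, u (k + 1) = u k - γ • gradient f (u k)) (p : E) (k : ℕ) :
    ‖u k - p‖ ^ 2 ≤ ‖u 0 - p‖ ^ 2 - 2 * (γ * k * ⟪gradient f (u 0), u 0 - p⟫)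
      + L * γ ^ 2 * G * k * (k - 1) * ‖u 0 - p‖ + (γ * k * G) ^ 2 := by
  have hdrift : ∀ j : ℕ, ‖u 0 - u j‖ ≤ γ * j * G := by
    intro j
    induction j with
    | zero => simp
    | succ j ih =>
      have hstep : u 0 - u (j + 1) = (u 0 - u j) + γ • gradient f (u j) := by rw [hu]; abel
      have hgr := mul_le_mul_of_nonneg_left (hG (u j)) hγ
      have htri := norm_add_le (u 0 - u j) (γ • gradient f (u j))
      rw [norm_smul, Real.norm_of_nonneg hγ] at htri
      rw [hstep]
      push_cast
      linarith
  have hprogress : ∀ j : ℕ, γ * j * ⟪gradient f (u 0), u 0 - p⟫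
      - L * γ ^ 2 * G * j * (j - 1) / 2 * ‖u 0 - p‖ ≤ ⟪u 0 - u j, u 0 - p⟫ := by
    intro j
    induction j with
    | zero => simp
    | succ j ih =>
      have hstep : u 0 - u (j + 1) = (u 0 - u j) + γ • gradient f (u j) := by rw [hu]; abel
      have hcs := le_of_abs_le
        (abs_real_inner_le_norm (gradient f (u 0) - gradient f (u j)) (u 0 - p))
      have herr : ‖gradient f (u 0) - gradient f (u j)‖ ≤ L * (γ * j * G) :=
        (hgrad _ _).trans (mul_le_mul_of_nonneg_left (hdrift j) hL)
      have hbound := mul_le_mul_of_nonneg_left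
        (hcs.trans (mul_le_mul_of_nonneg_right herr (norm_nonneg (u 0 - p)))) hγ
      rw [inner_sub_left] at hbound
      rw [hstep, inner_add_left, real_inner_smul_left]
      push_cast
      linarith
  have hsplit : u k - p = (u 0 - p) - (u 0 - u k) := by abel
  rw [hsplit, norm_sub_sq_real, real_inner_comm]
  have := pow_le_pow_left₀ (norm_nonneg _) (hdrift k) 2
  have := hprogress k
  linarith

end Analytic

lemma sum_sum_update_eq_card_mul {ι X : Type*} [Fintype ι] [DecidableEq ι] [Fintype X]
    (t : ι) (g : (ι → X) → ℝ) :
    ∑ ω : ι → X, ∑ x : X, g (Function.update ω t x) = Fintype.card X * ∑ ω : ι → X, g ω := by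
  have hswap : ∑ a : (ι → X) × X, g (Function.update a.1 t a.2) = ∑ a : (ι → X) × X, g a.1 :=
    Finset.sum_nbij' (fun a => (Function.update a.1 t a.2, a.1 t))
      (fun a => (Function.update a.1 t a.2, a.1 t)) (by simp) (by simp) (by simp) (by simp)
      (by simp)
  rw [← Fintype.sum_prod_type' (fun ω x => g (Function.update ω t x)), hswap,
    Fintype.sum_prod_type]
  simp [Finset.mul_sum]

section Averaged

variable {E ι X : Type*} [NormedAddCommGroup E] [Fintype ι] [Fintype X] [Nonempty X]
  {F : ι → E → ℝ} {a : X → E → ι → ℝ} {Fbar : E → ℝ} {G L γ : ℝ}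

lemma lipschitz_average_max (ha0 : ∀ x v i, 0 ≤ a x v i) (ha1 : ∀ x v, ∑ i, a x v i = 1)
    (hmax : ∀ x v z, ∑ i, a x z i * F i v ≤ ∑ i, a x v i * F i v)
    (hFbar : ∀ v, Fbar v = (∑ x, ∑ i, a x v i * F i v) / Fintype.card X)
    (hFlip : ∀ i v v', |F i v - F i v'| ≤ G * ‖v - v'‖) (v v' : E) :
    |Fbar v - Fbar v'| ≤ G * ‖v - v'‖ := by
  have hcard : (0 : ℝ) < Fintype.card X := by exact_mod_cast Fintype.card_pos
  have hone : ∀ v v', Fbar v - Fbar v' ≤ G * ‖v - v'‖ := by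
    intro v v'
    rw [hFbar, hFbar, ← sub_div, ← Finset.sum_sub_distrib, div_le_iff₀ hcard]
    have hx : ∀ x, ∑ i, a x v i * F i v - ∑ i, a x v' i * F i v' ≤ G * ‖v - v'‖ := by
      intro x
      calc ∑ i, a x v i * F i v - ∑ i, a x v' i * F i v'
          ≤ ∑ i, a x v i * F i v - ∑ i, a x v i * F i v' := by linarith [hmax x v' v]
        _ = ∑ i, a x v i * (F i v - F i v') := by
            rw [← Finset.sum_sub_distrib]
            simp only [mul_sub]
        _ ≤ ∑ i, a x v i * (G * ‖v - v'‖) := Finset.sum_le_sum fun i _ =>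
            mul_le_mul_of_nonneg_left (le_of_abs_le (hFlip i v v')) (ha0 x v i)
        _ = G * ‖v - v'‖ := by rw [← Finset.sum_mul, ha1, one_mul]
    calc _ ≤ ∑ _x : X, G * ‖v - v'‖ := Finset.sum_le_sum fun x _ => hx x
      _ = _ := by simp [mul_comm]
  refine abs_sub_le_iff.2 ⟨hone v v', ?_⟩
  rw [norm_sub_rev]
  exact hone v' v

variable [InnerProductSpace ℝ E] [CompleteSpace E]

lemma quadratic_minorant_average_max (ha0 : ∀ x v i, 0 ≤ a x v i)
    (ha1 : ∀ x v, ∑ i, a x v i = 1)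
    (hmax : ∀ x v z, ∑ i, a x z i * F i v ≤ ∑ i, a x v i * F i v)
    (hFbar : ∀ v, Fbar v = (∑ x, ∑ i, a x v i * F i v) / Fintype.card X)
    (hFdiff : ∀ i, Differentiable ℝ (F i))
    (hFgrad : ∀ i v v', ‖gradient (F i) v - gradient (F i) v'‖ ≤ L * ‖v - v'‖) (v z : E) :
    Fbar v + ⟪(Fintype.card X : ℝ)⁻¹ • ∑ x, ∑ i, a x v i • gradient (F i) v, z - v⟫
      - L / 2 * ‖z - v‖ ^ 2 ≤ Fbar z := by
  have hcard : (0 : ℝ) < Fintype.card X := by exact_mod_cast Fintype.card_pos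
  have hx : ∀ x, ∑ i, a x v i * F i v + ⟪∑ i, a x v i • gradient (F i) v, z - v⟫
      - L / 2 * ‖z - v‖ ^ 2 ≤ ∑ i, a x z i * F i z := by
    intro x
    calc _ = ∑ i, a x v i * (F i v + ⟪gradient (F i) v, z - v⟫ - L / 2 * ‖z - v‖ ^ 2) := by
          simp only [mul_sub, mul_add, Finset.sum_sub_distrib, Finset.sum_add_distrib,
            ← Finset.sum_mul, ha1, sum_inner, real_inner_smul_left, one_mul]
      _ ≤ ∑ i, a x v i * F i z := Finset.sum_le_sum fun i _ => mul_le_mul_of_nonneg_left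
          (quadratic_minorant_of_lipschitz_gradient (hFdiff i) (hFgrad i) v z) (ha0 x v i)
      _ ≤ _ := hmax x z v
  have hsum := Finset.sum_le_sum fun x (_ : x ∈ Finset.univ) => hx x
  rw [Finset.sum_sub_distrib, Finset.sum_add_distrib, ← sum_inner, Finset.sum_const,
    Finset.card_univ, nsmul_eq_mul] at hsum
  rw [hFbar, hFbar, le_div_iff₀ hcard, real_inner_smul_left]
  refine le_trans (le_of_eq ?_) hsum
  field_simp

/-- Expected decrease of the Moreau envelope `Φ` in one round started at `v`. -/
lemma moreau_envelope_round_descent [FiniteDimensional ℝ E]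
    (ha0 : ∀ x v i, 0 ≤ a x v i) (ha1 : ∀ x v, ∑ i, a x v i = 1)
    (hmax : ∀ x v z, ∑ i, a x z i * F i v ≤ ∑ i, a x v i * F i v)
    (hFbar : ∀ v, Fbar v = (∑ x, ∑ i, a x v i * F i v) / Fintype.card X)
    (hG : 0 ≤ G) (hL : 0 < L) (hγ : 0 ≤ γ)
    (hFlip : ∀ i v v', |F i v - F i v'| ≤ G * ‖v - v'‖)
    (hFdiff : ∀ i, Differentiable ℝ (F i))
    (hFgrad : ∀ i v v', ‖gradient (F i) v - gradient (F i) v'‖ ≤ L * ‖v - v'‖)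
    {Φ : E → ℝ} (hΦ : ∀ v, Φ v = sInf {y : ℝ | ∃ z, y = Fbar z + L * ‖v - z‖ ^ 2})
    {τ : ℕ} (hτ : 1 ≤ τ) (v : E) :
    ∑ x, Φ (∑ i, a x v i • (fun y => y - γ • gradient (F i) y)^[τ] v)
      ≤ Fintype.card X * (Φ v - τ * γ / 4 * ‖gradient Φ v‖ ^ 2
        + τ ^ 2 * γ ^ 2 * L * G ^ 2 * (1 + 8 * L * γ * ((τ : ℝ) - 1))) := by
  have hcard : (0 : ℝ) < Fintype.card X := by exact_mod_cast Fintype.card_pos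
  have hτ' : (1 : ℝ) ≤ τ := by exact_mod_cast hτ
  have hlip := lipschitz_average_max ha0 ha1 hmax hFbar hFlip
  have hsub := quadratic_minorant_average_max ha0 ha1 hmax hFbar hFdiff hFgrad
  have hΦle : ∀ x z, Φ x ≤ Fbar z + L * ‖x - z‖ ^ 2 := by
    intro x z
    obtain ⟨q, hq⟩ := exists_prox_of_lipschitz hL hlip x
    rw [hΦ]
    refine csInf_le ⟨Fbar q + L * ‖x - q‖ ^ 2, ?_⟩ ⟨z, rfl⟩
    rintro _ ⟨z', rfl⟩
    exact hq z'
  obtain ⟨p, hp⟩ := exists_prox_of_lipschitz hL hlip v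
  have hΦv : Φ v = Fbar p + L * ‖v - p‖ ^ 2 := by
    rw [hΦ]
    refine IsLeast.csInf_eq ⟨⟨p, rfl⟩, ?_⟩
    rintro _ ⟨z, rfl⟩
    exact hp z
  have hgradΦ := norm_gradient_le_of_quadratic_majorant hL.le (fun x => hΦle x p) hΦv
  have hgrowth := quadratic_growth_prox hsub hp
  set D := ‖v - p‖ with hD
  set g := fun x => ⟪∑ i, a x v i • gradient (F i) v, v - p⟫ with hg
  set R := L * γ ^ 2 * G * τ * (τ - 1) * D + (γ * τ * G) ^ 2 with hR
  have hround : ∀ x, Φ (∑ i, a x v i • (fun y => y - γ • gradient (F i) y)^[τ] v)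
      ≤ Fbar p + L * (D ^ 2 - 2 * (γ * τ * g x) + R) := by
    intro x
    refine (hΦle _ p).trans (add_le_add_right (mul_le_mul_of_nonneg_left ?_ hL.le) _)
    have hcentre : ∑ i, a x v i • (fun y => y - γ • gradient (F i) y)^[τ] v - p
        = ∑ i, a x v i • ((fun y => y - γ • gradient (F i) y)^[τ] v - p) := by
      simp only [smul_sub, Finset.sum_sub_distrib, ← Finset.sum_smul, ha1, one_smul]
    have hconv : ConvexOn ℝ Set.univ fun y : E => ‖y‖ ^ 2 :=
      convexOn_univ_norm.pow (fun _ _ => norm_nonneg _) 2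
    rw [hcentre]
    calc _ ≤ ∑ i, a x v i • ‖(fun y => y - γ • gradient (F i) y)^[τ] v - p‖ ^ 2 :=
          hconv.map_sum_le (fun i _ => ha0 x v i) (ha1 x v) (fun _ _ => Set.mem_univ _)
      _ ≤ ∑ i, a x v i • (D ^ 2 - 2 * (γ * τ * ⟪gradient (F i) v, v - p⟫) + R) := by
          refine Finset.sum_le_sum fun i _ => mul_le_mul_of_nonneg_left ?_ (ha0 x v i)
          have := gradientDescent_dist_sq_le (f := F i) hL.le hγ
            (norm_gradient_le_of_lipschitz hG (hFlip i)) (hFgrad i)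
            (u := fun k => (fun y => y - γ • gradient (F i) y)^[k] v)
            (fun k => Function.iterate_succ_apply' _ _ _) p τ
          simp only [Function.iterate_zero, id] at this
          linarith
      _ = _ := by
          have hgx : g x = ∑ i, a x v i * ⟪gradient (F i) v, v - p⟫ := by
            simp only [hg, sum_inner, real_inner_smul_left]
          have hpull : ∑ i, a x v i * (2 * (γ * τ * ⟪gradient (F i) v, v - p⟫))
              = 2 * (γ * τ * ∑ i, a x v i * ⟪gradient (F i) v, v - p⟫) := by
            simp only [Finset.mul_sum]
            exact Finset.sum_congr rfl fun i _ => by ring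
          simp only [smul_eq_mul, mul_add, mul_sub, Finset.sum_add_distrib,
            Finset.sum_sub_distrib, ← Finset.sum_mul, ha1, one_mul, hpull, hgx]
  have hinner : L * D ^ 2 * Fintype.card X ≤ ∑ x, g x := by
    have h := hsub v p
    rw [← neg_sub v p, inner_neg_right, norm_neg, real_inner_smul_left, sum_inner] at h
    rw [← le_div_iff₀ hcard, div_eq_inv_mul]
    linarith
  have hscalar : L * R + τ * γ / 4 * ‖gradient Φ v‖ ^ 2 ≤ 2 * L * (γ * τ) * (L * D ^ 2)
      + τ ^ 2 * γ ^ 2 * L * G ^ 2 * (1 + 8 * L * γ * ((τ : ℝ) - 1)) := by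
    have h1 : τ * γ / 4 * ‖gradient Φ v‖ ^ 2 ≤ τ * γ / 4 * (2 * L * D) ^ 2 := by gcongr
    have h2 : 0 ≤ γ * τ * L ^ 2 * (D - γ * G * (τ - 1) / 2) ^ 2 := by positivity
    have h3 : 0 ≤ τ * γ ^ 3 * L ^ 2 * G ^ 2 * ((τ - 1) * (8 * τ - (τ - 1) / 4)) :=
      mul_nonneg (by positivity) (mul_nonneg (by linarith) (by linarith))
    rw [hR]
    linarith
  calc _ ≤ ∑ x, (Fbar p + L * (D ^ 2 - 2 * (γ * τ * g x) + R)) :=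
        Finset.sum_le_sum fun x _ => hround x
    _ = Fintype.card X * (Φ v + L * R) - 2 * L * (γ * τ) * ∑ x, g x := by
        simp only [hΦv, mul_add, mul_sub, Finset.sum_add_distrib, Finset.sum_sub_distrib,
          Finset.sum_const, Finset.card_univ, nsmul_eq_mul, ← Finset.mul_sum]
        ring
    _ ≤ Fintype.card X * (Φ v + L * R) - 2 * L * (γ * τ) * (L * D ^ 2 * Fintype.card X) := by
        gcongr
    _ = Fintype.card X * (Φ v + L * R - 2 * L * (γ * τ) * (L * D ^ 2)) := by ring
    _ ≤ _ := mul_le_mul_of_nonneg_left (by linarith) hcard.le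

end Averaged

/-- Convergence of Δ-FL in the nonconvex case: for the federated process with per-round
uniform sampling of cohorts of size `m`, superquantile reweighting `sel`, `τ` local
gradient steps of size `γ ≤ 1/(4τL)`, and aggregation `w^{t+1} = ∑_{i∈S} π_i w_{i,τ}`,
the Moreau envelope `Φ̄_θ^{2L}` of the expected minibatch superquantile `F̄_θ` satisfies
`(1/T) ∑_{t<T} E‖∇Φ̄_θ^{2L}(w^t)‖² ≤ 4Δ/(τγT) + 4τγLG²(1 + 8Lγ(τ−1))` where
`Δ = Φ̄_θ^{2L}(w^0) − inf Φ̄_θ^{2L}`. The expectation is over the i.i.d. uniform choice of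
the cohorts `ω : Fin T → {S // |S| = m}`, realized as a finite average. -/
theorem deltaFL_nonconvex_convergence
    (d n m τ T : ℕ) (hn : 0 < n) (hm : 0 < m) (hmn : m ≤ n) (hτ : 1 ≤ τ) (hT : 0 < T)
    (θ G L γ : ℝ) (hθ : θ ∈ Set.Ioc (0:ℝ) 1) (hG : 0 < G) (hL : 0 < L)
    (hγpos : 0 < γ) (hγ : γ ≤ 1 / (4 * τ * L))
    (F : Fin n → EuclideanSpace ℝ (Fin d) → ℝ)
    (hFlip : ∀ i v v', |F i v - F i v'| ≤ G * ‖v - v'‖)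
    (hFc1 : ∀ i, ContDiff ℝ 1 (F i))
    (hFgrad : ∀ i v v', ‖gradient (F i) v - gradient (F i) v'‖ ≤ L * ‖v - v'‖)
    (sel : Finset (Fin n) → EuclideanSpace ℝ (Fin d) → Fin n → ℝ)
    (hsel : ∀ (S : Finset (Fin n)) v, S.card = m →
      (∀ i, 0 ≤ sel S v i) ∧ (∀ i ∉ S, sel S v i = 0) ∧ (∑ i ∈ S, sel S v i = 1) ∧
      (∀ i, sel S v i ≤ 1 / (θ * m)) ∧
      ∀ π : Fin n → ℝ, (∀ i, 0 ≤ π i) → (∀ i ∉ S, π i = 0) → (∑ i ∈ S, π i = 1) →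
        (∀ i, π i ≤ 1 / (θ * m)) →
        ∑ i ∈ S, π i * F i v ≤ ∑ i ∈ S, sel S v i * F i v)
    (w0 : EuclideanSpace ℝ (Fin d))
    (w : (Fin T → {S : Finset (Fin n) // S.card = m}) → ℕ → EuclideanSpace ℝ (Fin d))
    (u : (Fin T → {S : Finset (Fin n) // S.card = m}) → Fin T → Fin n → ℕ →
      EuclideanSpace ℝ (Fin d))
    (hw0 : ∀ ω, w ω 0 = w0)
    (hu0 : ∀ ω t i, u ω t i 0 = w ω (t : ℕ))
    (hurec : ∀ ω t i k, u ω t i (k + 1) = u ω t i k - γ • gradient (F i) (u ω t i k))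
    (hwrec : ∀ ω (t : Fin T),
      w ω ((t : ℕ) + 1) = ∑ i ∈ (ω t).1, sel (ω t).1 (w ω (t : ℕ)) i • u ω t i τ) :
    ∀ Fbar : EuclideanSpace ℝ (Fin d) → ℝ,
      Fbar = (fun v =>
        (∑ S ∈ Finset.univ.filter (fun S : Finset (Fin n) => S.card = m),
          sSup {y : ℝ | ∃ π : Fin n → ℝ, (∀ i, 0 ≤ π i) ∧ (∀ i ∉ S, π i = 0) ∧
            (∑ i ∈ S, π i = 1) ∧ (∀ i, π i ≤ 1 / (θ * m)) ∧ y = ∑ i ∈ S, π i * F i v})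
          / (n.choose m : ℝ)) →
    ∀ Φ : EuclideanSpace ℝ (Fin d) → ℝ,
      Φ = (fun v => sInf {y : ℝ | ∃ z, y = Fbar z + (2 * L) / 2 * ‖v - z‖ ^ 2}) →
    BddBelow (Set.range Φ) →
    (1 / (T : ℝ)) * ∑ t ∈ Finset.range T,
        (∑ ω : Fin T → {S : Finset (Fin n) // S.card = m}, ‖gradient Φ (w ω t)‖ ^ 2) /
          (Fintype.card (Fin T → {S : Finset (Fin n) // S.card = m}) : ℝ)
      ≤ 4 * (Φ w0 - sInf (Set.range Φ)) / (τ * γ * T)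
        + 4 * τ * γ * L * G ^ 2 * (1 + 8 * L * γ * ((τ : ℝ) - 1)) := by
  intro Fbar hFbar Φ hΦ hbdd
  have hcardX : Fintype.card {S : Finset (Fin n) // S.card = m} = n.choose m := by
    rw [Fintype.card_finset_len, Fintype.card_fin]
  have : Nonempty {S : Finset (Fin n) // S.card = m} := by
    rw [← Fintype.card_pos_iff, hcardX]
    exact Nat.choose_pos hmn
  have hsum : ∀ (S : {S : Finset (Fin n) // S.card = m}) (π : Fin n → ℝ),
      (∀ i ∉ S.1, π i = 0) → ∀ f : Fin n → ℝ, ∑ i ∈ S.1, π i * f i = ∑ i, π i * f i :=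
    fun S π hπ f => Finset.sum_subset (Finset.subset_univ _) fun i _ hi => by
      rw [hπ i hi, zero_mul]
  have ha1 : ∀ (S : {S : Finset (Fin n) // S.card = m}) v, ∑ i, sel S.1 v i = 1 := by
    intro S v
    obtain ⟨-, hz, h1, -, -⟩ := hsel S.1 v S.2
    simpa [h1] using (hsum S _ hz fun _ => 1).symm
  have hmax : ∀ (S : {S : Finset (Fin n) // S.card = m}) v z,
      ∑ i, sel S.1 z i * F i v ≤ ∑ i, sel S.1 v i * F i v := by
    intro S v z
    obtain ⟨-, hz, -, -, hopt⟩ := hsel S.1 v S.2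
    obtain ⟨h0', hz', h1', hub', -⟩ := hsel S.1 z S.2
    rw [← hsum S _ hz, ← hsum S _ hz']
    exact hopt _ h0' hz' h1' hub'
  have hFbar' : ∀ v, Fbar v = (∑ S : {S : Finset (Fin n) // S.card = m},
      ∑ i, sel S.1 v i * F i v) / Fintype.card {S : Finset (Fin n) // S.card = m} := by
    intro v
    rw [hFbar, hcardX]
    dsimp only
    rw [Finset.sum_subtype (p := fun S : Finset (Fin n) => S.card = m) _ (by simp)]
    congr 1
    refine Finset.sum_congr rfl fun S _ => ?_
    obtain ⟨h0, hz, h1, hub, hopt⟩ := hsel S.1 v S.2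
    rw [← hsum S _ hz]
    refine IsGreatest.csSup_eq ⟨⟨_, h0, hz, h1, hub, rfl⟩, ?_⟩
    rintro _ ⟨π, h0', hz', h1', hub', rfl⟩
    exact hopt π h0' hz' h1' hub'
  have hu : ∀ ω t i k, u ω t i k = (fun y => y - γ • gradient (F i) y)^[k] (w ω t) := by
    intro ω t i k
    induction k with
    | zero => exact hu0 ω t i
    | succ k ih => rw [hurec, Function.iterate_succ_apply', ih]
  have hstep : ∀ ω (t : Fin T), w ω (t + 1) = ∑ i, sel (ω t).1 (w ω t) i •
      (fun y => y - γ • gradient (F i) y)^[τ] (w ω t) := by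
    intro ω t
    rw [hwrec]
    simp only [hu]
    refine Finset.sum_subset (Finset.subset_univ _) fun i _ hi => ?_
    rw [(hsel _ _ (ω t).2).2.1 i hi, zero_smul]
  -- `w ω s` only depends on the cohorts of the rounds before `s`
  have hadapted : ∀ (t : Fin T) (S : {S : Finset (Fin n) // S.card = m}) ω (s : ℕ), s ≤ t →
      w (Function.update ω t S) s = w ω s := by
    intro t S ω s
    induction s with
    | zero => intro _; rw [hw0, hw0]
    | succ s ih =>
      intro hs
      have hlt : s < T := by omega
      have hne : (⟨s, hlt⟩ : Fin T) ≠ t := by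
        rintro rfl
        simp at hs
      have h1 := hstep (Function.update ω t S) ⟨s, hlt⟩
      have h2 := hstep ω ⟨s, hlt⟩
      simp only [Function.update_of_ne hne, ih (by omega)] at h1 h2
      rw [h1, h2]
  set N : ℝ := ((Fintype.card (Fin T → {S : Finset (Fin n) // S.card = m}) : ℕ) : ℝ) with hN
  have hNpos : 0 < N := by
    rw [hN]
    exact_mod_cast Fintype.card_pos
  set C : ℝ := τ ^ 2 * γ ^ 2 * L * G ^ 2 * (1 + 8 * L * γ * ((τ : ℝ) - 1)) with hC
  have hround : ∀ t ∈ Finset.range T,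
      τ * γ / 4 * ((∑ ω, ‖gradient Φ (w ω t)‖ ^ 2) / N)
        ≤ (∑ ω, Φ (w ω t)) / N - (∑ ω, Φ (w ω (t + 1))) / N + C := by
    intro t ht
    have hcpos : (0 : ℝ) < Fintype.card {S : Finset (Fin n) // S.card = m} := by
      exact_mod_cast Fintype.card_pos
    have hdescent := fun v => moreau_envelope_round_descent
      (a := fun (S : {S : Finset (Fin n) // S.card = m}) v => sel S.1 v)
      (fun S v => (hsel S.1 v S.2).1) ha1 hmax hFbar' hG.le hL hγpos.le hFlip
      (fun i => (hFc1 i).differentiable one_ne_zero) hFgrad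
      (Φ := Φ) (fun v => by rw [hΦ, mul_div_cancel_left₀ L two_ne_zero]) hτ v
    have hresample := sum_sum_update_eq_card_mul (⟨t, Finset.mem_range.1 ht⟩ : Fin T)
      fun ω => Φ (w ω (t + 1))
    have hupd : ∀ (ω : Fin T → {S : Finset (Fin n) // S.card = m}) S,
        w (Function.update ω ⟨t, Finset.mem_range.1 ht⟩ S) (t + 1)
          = ∑ i, sel S.1 (w ω t) i • (fun y => y - γ • gradient (F i) y)^[τ] (w ω t) := by
      intro ω S
      have h := hstep (Function.update ω ⟨t, Finset.mem_range.1 ht⟩ S)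
        ⟨t, Finset.mem_range.1 ht⟩
      simpa only [Function.update_self, hadapted ⟨t, Finset.mem_range.1 ht⟩ S ω t le_rfl]
        using h
    simp only [hupd] at hresample
    have htotal := Finset.sum_le_sum fun ω
      (_ : ω ∈ (Finset.univ : Finset (Fin T → {S : Finset (Fin n) // S.card = m}))) =>
        hdescent (w ω t)
    rw [hresample, ← Finset.mul_sum, ← hC] at htotal
    have hle := le_of_mul_le_mul_left htotal hcpos
    rw [Finset.sum_add_distrib, Finset.sum_sub_distrib, ← Finset.mul_sum, Finset.sum_const,
      Finset.card_univ, nsmul_eq_mul, ← hN] at hle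
    have hdiv : (∑ ω, Φ (w ω t)) / N - (∑ ω, Φ (w ω (t + 1))) / N + C
        = ((∑ ω, Φ (w ω t)) - (∑ ω, Φ (w ω (t + 1))) + N * C) / N := by
      field_simp
    rw [hdiv, ← mul_div_assoc]
    exact div_le_div_of_nonneg_right (by linarith) hNpos.le
  have htele := Finset.sum_le_sum hround
  rw [← Finset.mul_sum, Finset.sum_add_distrib,
    Finset.sum_range_sub' (fun t => (∑ ω, Φ (w ω t)) / N), Finset.sum_const,
    Finset.card_range, nsmul_eq_mul] at htele
  have hstart : (∑ ω, Φ (w ω 0)) / N = Φ w0 := by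
    simp only [hw0, Finset.sum_const, Finset.card_univ, nsmul_eq_mul, ← hN]
    field_simp
  have hend : sInf (Set.range Φ) ≤ (∑ ω, Φ (w ω T)) / N := by
    rw [le_div_iff₀ hNpos]
    have := Finset.card_nsmul_le_sum Finset.univ (fun ω => Φ (w ω T)) (sInf (Set.range Φ))
      fun ω _ => csInf_le hbdd ⟨_, rfl⟩
    rw [Finset.card_univ, nsmul_eq_mul, ← hN] at this
    linarith
  have hTpos : (0 : ℝ) < T := by exact_mod_cast hT
  have hτpos : (0 : ℝ) < τ := by exact_mod_cast hτ
  have hrhs : 4 * (Φ w0 - sInf (Set.range Φ)) / (τ * γ * T)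
        + 4 * τ * γ * L * G ^ 2 * (1 + 8 * L * γ * ((τ : ℝ) - 1))
      = (4 / (τ * γ * T)) * (Φ w0 - sInf (Set.range Φ) + T * C) := by
    rw [hC]
    field_simp
  have hlhs : ∀ A : ℝ, 1 / (T : ℝ) * A = (4 / (τ * γ * T)) * (τ * γ / 4 * A) := by
    intro A
    field_simp
  rw [hrhs, hlhs]
  refine mul_le_mul_of_nonneg_left ?_ (by positivity)
  rw [hstart] at htele
  linarith
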